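/- For all natural numbers i, j, d with i ≥ j and j ≥ d + 4, occ(F_{i−d}, F_i) = occ(F_{j−d}, F_j); i.e., the number of occurrences of the Fibonacci word of order i−d in the Fibonacci word of order i depends only on the offset d. -/

import Mathlib

/-- Extension of a letter map `φ` to a morphism on words. -/
def wlift {α β : Type*} (φ : α → List β) (u : List α) : List β := (u.map φ).flatten

/-- Set of starting positions (0-indexed) of occurrences of `u` in `w`. -/
def Occ {β : Type*} (u w : List β) : Set ℕ := {i | i ≤ w.length ∧ u <+: w.drop i}

/-- Number of occurrences of `u` as a factor of `w`. -/
noncomputable def occ {β : Type*} (u w : List β) : ℕ := (Occ u w).ncard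

/-- The binary alphabet. -/
inductive Ltr : Type
  | a : Ltr
  | b : Ltr

/-- The Fibonacci morphism: a ↦ ab, b ↦ a. -/
def fib : Ltr → List Ltr
  | Ltr.a => [Ltr.a, Ltr.b]
  | Ltr.b => [Ltr.a]

/-- The Fibonacci word of order `i`: `F i = φ^{i-1}(b)`. -/
def F (i : ℕ) : List Ltr := (wlift fib)^[i - 1] [Ltr.b]

open Ltr

theorem finite_Occ {β : Type*} (u w : List β) : (Occ u w).Finite :=
  (Set.finite_Iic w.length).subset fun _ h => h.1

theorem occ_cons_of_prefix {β : Type*} {u w : List β} {c : β} (h : u <+: c :: w) :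
    occ u (c :: w) = occ u w + 1 := by
  have hO : Occ u (c :: w) = insert 0 (Nat.succ '' Occ u w) := by
    ext (_ | n) <;> simp [Occ, h]
  rw [occ, hO, Set.ncard_insert_of_notMem (by simp) ((finite_Occ u w).image _),
    Set.ncard_image_of_injective _ Nat.succ_injective, occ]

theorem occ_cons_of_not_prefix {β : Type*} {u w : List β} {c : β} (h : ¬ u <+: c :: w) :
    occ u (c :: w) = occ u w := by
  have hO : Occ u (c :: w) = Nat.succ '' Occ u w := by
    ext (_ | n) <;> simp [Occ, h]
  rw [occ, hO, Set.ncard_image_of_injective _ Nat.succ_injective, occ]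

theorem occ_nil {β : Type*} {u : List β} (h : u ≠ []) : occ u [] = 0 := by
  have hO : Occ u ([] : List β) = ∅ := by
    ext n
    simp [Occ, h]
  rw [occ, hO, Set.ncard_empty]

@[simp] theorem wlift_nil {α β : Type*} (φ : α → List β) : wlift φ [] = [] := rfl

@[simp] theorem wlift_cons {α β : Type*} (φ : α → List β) (c : α) (u : List α) :
    wlift φ (c :: u) = φ c ++ wlift φ u := rfl

@[simp] theorem wlift_append {α β : Type*} (φ : α → List β) (u v : List α) :
    wlift φ (u ++ v) = wlift φ u ++ wlift φ v := by
  simp [wlift]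

theorem wlift_prefix {α β : Type*} (φ : α → List β) {u w : List α} (h : u <+: w) :
    wlift φ u <+: wlift φ w := by
  obtain ⟨t, rfl⟩ := h
  simp

theorem wlift_fib_eq_cons {u : List Ltr} (h : u ≠ []) : ∃ v, wlift fib u = a :: v := by
  match u, h with
  | a :: _, _ => exact ⟨_, rfl⟩
  | b :: _, _ => exact ⟨_, rfl⟩

theorem not_b_cons_prefix_wlift_fib (u w : List Ltr) : ¬ b :: u <+: wlift fib w := by
  rcases w with _ | ⟨_ | _, w⟩ <;> simp [fib]

theorem prefix_of_wlift_fib_prefix_of_a {u w : List Ltr}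
    (h : wlift fib (u ++ [a]) <+: wlift fib w) : u ++ [a] <+: w := by
  induction u generalizing w with
  | nil =>
    rcases w with _ | ⟨_ | _, w⟩
    · simp [fib] at h
    · simp
    · simp [fib, not_b_cons_prefix_wlift_fib] at h
  | cons c u ih =>
    obtain ⟨v, hv⟩ := wlift_fib_eq_cons (u := u ++ [a]) (by simp)
    rcases c with _ | _ <;> rcases w with _ | ⟨_ | _, w⟩ <;>
      simp only [List.cons_append, wlift_cons, wlift_nil, fib, List.nil_append,
        List.cons_prefix_cons, true_and, List.prefix_nil, reduceCtorEq] at h ⊢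
    · exact ih h
    · exact (not_b_cons_prefix_wlift_fib _ _ h).elim
    · simp [hv] at h
    · exact ih h

theorem prefix_of_wlift_fib_prefix_of_aab {u w : List Ltr} (hw : ¬ [a, a, a] <:+: w)
    (h : wlift fib (u ++ [a, a, b]) <+: wlift fib w) : u ++ [a, a, b] <+: w := by
  have hu : u ++ [a, a, b] = (u ++ [a] ++ [a]) ++ [b] := by simp
  rw [hu] at h ⊢
  rw [wlift_append] at h
  obtain ⟨t, rfl⟩ := prefix_of_wlift_fib_prefix_of_a ((List.prefix_append _ _).trans h)
  rw [wlift_append _ (u ++ [a] ++ [a]) t, List.prefix_append_right_inj] at h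
  rw [List.prefix_append_right_inj]
  rcases t with _ | ⟨_ | _, t⟩
  · simp [fib] at h
  · exact absurd ⟨u, t, by simp⟩ hw
  · simp

theorem occ_wlift_fib {u w : List Ltr} (hu : u ≠ [])
    (h : ∀ v, v <:+ w → wlift fib u <+: wlift fib v → u <+: v) :
    occ (wlift fib u) (wlift fib w) = occ u w := by
  obtain ⟨x, hx⟩ := wlift_fib_eq_cons hu
  induction w with
  | nil => rw [wlift_nil, occ_nil hu, occ_nil (by simp [hx])]
  | cons c w ih =>
    have ih := ih fun v hv => h v (hv.trans (List.suffix_cons c w))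
    obtain ⟨y, hy, hyw⟩ : ∃ y, wlift fib (c :: w) = a :: y ∧
        occ (wlift fib u) y = occ (wlift fib u) (wlift fib w) := by
      rcases c with _ | _
      · exact ⟨_, rfl, occ_cons_of_not_prefix (by simp [hx])⟩
      · exact ⟨_, rfl, rfl⟩
    by_cases hp : u <+: c :: w
    · rw [occ_cons_of_prefix hp, hy, occ_cons_of_prefix (hy ▸ wlift_prefix fib hp), hyw, ih]
    · have hq : ¬ wlift fib u <+: a :: y := hy ▸ fun hq => hp (h _ List.suffix_rfl hq)
      rw [occ_cons_of_not_prefix hp, hy, occ_cons_of_not_prefix hq, hyw, ih]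

theorem not_bb_infix_wlift_fib (w : List Ltr) : ¬ [b, b] <:+: wlift fib w := by
  induction w with
  | nil => simp
  | cons c w ih =>
    rcases c with _ | _ <;>
      simp [fib, List.infix_cons_iff, ih, not_b_cons_prefix_wlift_fib]

theorem not_aaa_infix_wlift_fib {w : List Ltr} (hw : ¬ [b, b] <:+: w) :
    ¬ [a, a, a] <:+: wlift fib w := by
  induction w with
  | nil => simp
  | cons c w ih =>
    have ih := ih fun h => hw (List.infix_cons h)
    rcases c with _ | _
    · simp [fib, List.infix_cons_iff, ih]
    · rcases w with _ | ⟨_ | _, w⟩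
      · simp [fib, List.infix_cons_iff]
      · simpa [fib, List.infix_cons_iff] using ih
      · simp [List.infix_cons_iff] at hw

theorem F_succ {n : ℕ} (hn : 1 ≤ n) : F (n + 1) = wlift fib (F n) := by
  obtain ⟨m, rfl⟩ := Nat.exists_eq_add_of_le' hn
  exact Function.iterate_succ_apply' _ _ _

theorem not_bb_infix_F {n : ℕ} (hn : 1 ≤ n) : ¬ [b, b] <:+: F n := by
  induction n, hn using Nat.le_induction with
  | base => simp [F, List.infix_cons_iff]
  | succ n hn _ => exact F_succ hn ▸ not_bb_infix_wlift_fib _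

theorem not_aaa_infix_F {n : ℕ} (hn : 1 ≤ n) : ¬ [a, a, a] <:+: F n := by
  induction n, hn using Nat.le_induction with
  | base => simp [F, List.infix_cons_iff]
  | succ n hn _ => exact F_succ hn ▸ not_aaa_infix_wlift_fib (not_bb_infix_F hn)

theorem exists_F_eq_append {n : ℕ} (hn : 4 ≤ n) :
    ∃ u, F n = u ++ [b, a] ∨ F n = u ++ [a, a, b] := by
  induction n, hn using Nat.le_induction with
  | base => exact ⟨[a], Or.inl rfl⟩
  | succ n hn ih =>
    rw [F_succ (by omega)]
    obtain ⟨u, h | h⟩ := ih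
    · exact ⟨wlift fib u, Or.inr (by simp [h, fib])⟩
    · exact ⟨wlift fib u ++ [a, b, a], Or.inl (by simp [h, fib])⟩

theorem occ_F_succ {k n : ℕ} (hk : 4 ≤ k) (hn : 1 ≤ n) :
    occ (F (k + 1)) (F (n + 1)) = occ (F k) (F n) := by
  rw [F_succ (by omega), F_succ hn]
  obtain ⟨u, h | h⟩ := exists_F_eq_append hk <;> rw [h] <;> refine occ_wlift_fib (by simp) ?_
  · intro v _ hv
    rw [show u ++ [b, a] = (u ++ [b]) ++ [a] by simp] at hv ⊢
    exact prefix_of_wlift_fib_prefix_of_a hv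
  · intro v hvw hv
    exact prefix_of_wlift_fib_prefix_of_aab
      (fun h => not_aaa_infix_F hn (h.trans hvw.isInfix)) hv

theorem occ_f_i_d :
    ∀ i j d : ℕ, j ≤ i → d + 4 ≤ j →
      occ (F (i - d)) (F i) = occ (F (j - d)) (F j) := by
  intro i j d hij hdj
  induction i, hij using Nat.le_induction with
  | base => rfl
  | succ i hji ih =>
    rw [← ih, Nat.sub_add_comm (by omega), occ_F_succ (by omega) (by omega)]
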